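/- arXiv:2112.01190 — 5 statements merged into one kernel-verified Lean document; each statement's English description precedes it below -/
import Mathlib

section
/- For every x ≥ 0, the iterated integral of the (δ+γ)-scale function satisfies ∫₀ˣ (∫₀^y W_{δ+γ}(u) du) dy = (1/θ₃²) W_{δ+γ}(x) + (c/(δ+γ)²) e^{θ₄ x} − c/(δ+γ)² − x/(δ+γ). -/
open Real intervalIntegral

theorem aux_int (A : ℝ) (hA : A ≠ 0) (y : ℝ) :
    ∫ u in (0:ℝ)..y, Real.exp (A * u) = (Real.exp (A * y) - 1) / A := by
  rw [intervalIntegral.integral_comp_mul_left (fun u => Real.exp u) hA]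
  simp [integral_exp]
  field_simp

theorem aux_outer (l A B : ℝ) (hA : A ≠ 0) (hB : B ≠ 0) (x : ℝ) :
    ∫ y in (0:ℝ)..x, l * ((Real.exp (A * y) - 1) / A - (Real.exp (B * y) - 1) / B)
      = l * (((Real.exp (A * x) - 1) / A - x) / A - ((Real.exp (B * x) - 1) / B - x) / B) := by
  have hi : ∀ C : ℝ, IntervalIntegrable (fun y => Real.exp (C * y)) MeasureTheory.volume 0 x :=
    fun C => Continuous.intervalIntegrable (by fun_prop) _ _
  have hj : ∀ C : ℝ, IntervalIntegrable (fun y => (Real.exp (C * y) - 1) / C) MeasureTheory.volume 0 x :=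
    fun C => Continuous.intervalIntegrable (by fun_prop) _ _
  rw [intervalIntegral.integral_const_mul, intervalIntegral.integral_sub (hj A) (hj B),
    intervalIntegral.integral_div, intervalIntegral.integral_div,
    intervalIntegral.integral_sub (hi A) (by simp), intervalIntegral.integral_sub (hi B) (by simp),
    aux_int A hA, aux_int B hB]
  simp

theorem brownian_iterated_integral_scale_function
    (c σ δ γ : ℝ) (hσ : 0 < σ) (hδ : 0 < δ) (hγ : 0 < γ) :
    let Δ : ℝ := Real.sqrt (c ^ 2 + 2 * (δ + γ) * σ ^ 2)
    let θ₃ : ℝ := (-c + Δ) / σ ^ 2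
    let θ₄ : ℝ := (-c - Δ) / σ ^ 2
    let l : ℝ := 1 / Δ
    let Wg : ℝ → ℝ := fun x =>
      if x < 0 then 0 else l * (Real.exp (θ₃ * x) - Real.exp (θ₄ * x))
    ∀ x : ℝ, 0 ≤ x →
      (∫ y in (0 : ℝ)..x, ∫ u in (0 : ℝ)..y, Wg u) =
        1 / θ₃ ^ 2 * Wg x + c / (δ + γ) ^ 2 * Real.exp (θ₄ * x)
          - c / (δ + γ) ^ 2 - x / (δ + γ) := by
  intro Δ A B l Wg x hx
  have hq : 0 < δ + γ := by positivity
  have hs : σ ^ 2 ≠ 0 := by positivity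
  have hD : 0 < Δ := Real.sqrt_pos.mpr (by positivity)
  have hD2 : Δ ^ 2 = c ^ 2 + 2 * (δ + γ) * σ ^ 2 := Real.sq_sqrt (by positivity)
  have hprod : A * B = -(2 * (δ + γ)) / σ ^ 2 := by
    simp only [A, B]
    field_simp
    linear_combination -hD2
  have hAB : A * B ≠ 0 := by
    rw [hprod]
    exact div_ne_zero (by linarith) hs
  have hA : A ≠ 0 := left_ne_zero_of_mul hAB
  have hB : B ≠ 0 := right_ne_zero_of_mul hAB
  have hdiff : A - B = 2 * Δ / σ ^ 2 := by simp only [A, B]; ring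
  have hsum : A + B = -(2 * c) / σ ^ 2 := by simp only [A, B]; ring
  have k1 : l * (1 / B - 1 / A) = -(1 / (δ + γ)) := by
    have : 1 / B - 1 / A = (A - B) / (A * B) := by field_simp
    rw [this, hdiff, hprod]
    simp only [l]
    field_simp
  have k2 : l * (1 / A ^ 2 - 1 / B ^ 2) = c / (δ + γ) ^ 2 := by
    have : 1 / A ^ 2 - 1 / B ^ 2 = -((A - B) * (A + B)) / (A * B) ^ 2 := by
      field_simp
      ring
    rw [this, hdiff, hsum, hprod]
    simp only [l]
    field_simp
    try ring
  have hW : ∀ u, 0 ≤ u → Wg u = l * (Real.exp (A * u) - Real.exp (B * u)) := fun u hu => by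
    simp only [Wg, if_neg (not_lt.mpr hu)]
  have hinner : ∀ y, 0 ≤ y → ∫ u in (0:ℝ)..y, Wg u
      = l * ((Real.exp (A * y) - 1) / A - (Real.exp (B * y) - 1) / B) := fun y hy => by
    have hi : ∀ C : ℝ, IntervalIntegrable (fun y => Real.exp (C * y)) MeasureTheory.volume 0 y :=
      fun C => Continuous.intervalIntegrable (by fun_prop) _ _
    rw [← aux_int A hA, ← aux_int B hB, ← intervalIntegral.integral_sub (hi A) (hi B),
      ← intervalIntegral.integral_const_mul]
    apply intervalIntegral.integral_congr
    intro u hu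
    rw [Set.uIcc_of_le hy] at hu
    exact hW u hu.1
  have houter : (∫ y in (0 : ℝ)..x, ∫ u in (0 : ℝ)..y, Wg u) =
      ∫ y in (0:ℝ)..x, l * ((Real.exp (A * y) - 1) / A - (Real.exp (B * y) - 1) / B) := by
    apply intervalIntegral.integral_congr
    intro u hu
    rw [Set.uIcc_of_le hx] at hu
    exact hinner u hu.1
  rw [houter, aux_outer l A B hA hB, hW x hx, ← k2]
  clear houter hinner hW hsum hdiff hprod hD2 hD
  clear_value Wg l A B
  linear_combination x * k1
end

section
/- For every a ≥ 0, evaluating the two-parameter scale function Z_δ(a,θ) = e^{θa}(1 + (δ − ψ(θ))∫₀^a e^{−θu} W_δ(u) du) at θ = θ₃ (the largest root of ψ(θ) = δ + γ, which satisfies θ₃ > θ₁) gives the closed form Z_δ(a, θ₃) = (γ/(θ₃ − θ₁)) W_δ(a) + e^{θ₂ a}. -/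
open Real intervalIntegral

theorem aux_Z (t1 t2 t3 κ γ a : ℝ) (h1 : t1 < t3) (h2 : t2 < t3)
    (hK : γ * κ * (t1 - t2) = (t3 - t1) * (t3 - t2)) :
    Real.exp (t3 * a) * (1 + (-γ) * ∫ u in (0 : ℝ)..a,
      Real.exp (-t3 * u) * (κ * (Real.exp (t1 * u) - Real.exp (t2 * u)))) =
    γ / (t3 - t1) * (κ * (Real.exp (t1 * a) - Real.exp (t2 * a))) + Real.exp (t2 * a) := by
  have hp : t3 - t1 ≠ 0 := (sub_pos.2 h1).ne'
  have hq : t3 - t2 ≠ 0 := (sub_pos.2 h2).ne'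
  have hd : ∀ (s u : ℝ), HasDerivAt (fun u : ℝ => Real.exp (s * u)) (Real.exp (s * u) * s) u := by
    intro s u
    simpa using ((hasDerivAt_id u).const_mul s).exp
  have hI : ∫ u in (0 : ℝ)..a,
      Real.exp (-t3 * u) * (κ * (Real.exp (t1 * u) - Real.exp (t2 * u))) =
      κ * (Real.exp ((t2 - t3) * a) / (t3 - t2) - Real.exp ((t1 - t3) * a) / (t3 - t1))
      - κ * (Real.exp ((t2 - t3) * 0) / (t3 - t2) - Real.exp ((t1 - t3) * 0) / (t3 - t1)) := by
    refine intervalIntegral.integral_eq_sub_of_hasDerivAt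
      (f := fun u => κ * (Real.exp ((t2 - t3) * u) / (t3 - t2) - Real.exp ((t1 - t3) * u) / (t3 - t1)))
      (fun u _ => ?_) (Continuous.intervalIntegrable (by fun_prop) _ _)
    have h := (((hd (t2 - t3) u).div_const (t3 - t2)).sub
      ((hd (t1 - t3) u).div_const (t3 - t1))).const_mul κ
    refine h.congr_deriv ?_
    have e1 : Real.exp ((t1 - t3) * u) = Real.exp (-t3 * u) * Real.exp (t1 * u) := by
      rw [← Real.exp_add]; ring_nf
    have e2 : Real.exp ((t2 - t3) * u) = Real.exp (-t3 * u) * Real.exp (t2 * u) := by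
      rw [← Real.exp_add]; ring_nf
    rw [e1, e2]
    field_simp
    ring
  rw [hI]
  have e1 : Real.exp (t1 * a) = Real.exp (t3 * a) * Real.exp ((t1 - t3) * a) := by
    rw [← Real.exp_add]; ring_nf
  have e2 : Real.exp (t2 * a) = Real.exp (t3 * a) * Real.exp ((t2 - t3) * a) := by
    rw [← Real.exp_add]; ring_nf
  rw [e1, e2, mul_zero, mul_zero, Real.exp_zero]
  generalize Real.exp ((t1 - t3) * a) = A
  generalize Real.exp ((t2 - t3) * a) = B
  generalize Real.exp (t3 * a) = C
  field_simp
  linear_combination (C * (B - 1)) * hK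

theorem brownian_Z_two_param_closed_form
    (c σ δ γ : ℝ) (hσ : 0 < σ) (hδ : 0 < δ) (hγ : 0 < γ) :
    let ψ : ℝ → ℝ := fun θ => c * θ + σ ^ 2 / 2 * θ ^ 2
    let Δ : ℝ := Real.sqrt (c ^ 2 + 2 * δ * σ ^ 2)
    let θ₁ : ℝ := (-c + Δ) / σ ^ 2
    let θ₂ : ℝ := (-c - Δ) / σ ^ 2
    let κ : ℝ := 1 / Δ
    let W : ℝ → ℝ := fun x =>
      if x < 0 then 0 else κ * (Real.exp (θ₁ * x) - Real.exp (θ₂ * x))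
    let θ₃ : ℝ := (-c + Real.sqrt (c ^ 2 + 2 * (δ + γ) * σ ^ 2)) / σ ^ 2
    let Z : ℝ → ℝ → ℝ := fun a θ =>
      Real.exp (θ * a) *
        (1 + (δ - ψ θ) * ∫ u in (0 : ℝ)..a, Real.exp (-θ * u) * W u)
    ψ θ₃ = δ + γ ∧ θ₁ < θ₃ ∧
      ∀ a : ℝ, 0 ≤ a →
        Z a θ₃ = γ / (θ₃ - θ₁) * W a + Real.exp (θ₂ * a) := by
  intro ψ Δ θ₁ θ₂ κ W θ₃ Z
  have hs : 0 < σ ^ 2 := by positivity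
  have hΔ : 0 < Δ := Real.sqrt_pos.2 (by positivity)
  have hΔ2 : Δ ^ 2 = c ^ 2 + 2 * δ * σ ^ 2 := Real.sq_sqrt (by positivity)
  have hE2 : Real.sqrt (c ^ 2 + 2 * (δ + γ) * σ ^ 2) ^ 2 = c ^ 2 + 2 * (δ + γ) * σ ^ 2 :=
    Real.sq_sqrt (by positivity)
  have hlt : Δ < Real.sqrt (c ^ 2 + 2 * (δ + γ) * σ ^ 2) :=
    Real.sqrt_lt_sqrt (by positivity) (by nlinarith [mul_pos hγ hs])
  have h3 : θ₃ = (-c + Real.sqrt (c ^ 2 + 2 * (δ + γ) * σ ^ 2)) / σ ^ 2 := rfl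
  generalize Real.sqrt (c ^ 2 + 2 * (δ + γ) * σ ^ 2) = E at hE2 hlt h3
  have hψ : ψ θ₃ = δ + γ := by
    change c * θ₃ + σ ^ 2 / 2 * θ₃ ^ 2 = δ + γ
    rw [h3]
    field_simp
    linear_combination hE2
  have h13 : θ₁ < θ₃ := by
    rw [h3]
    exact div_lt_div_of_pos_right (by linarith) hs
  have h23 : θ₂ < θ₃ := by
    rw [h3]
    exact div_lt_div_of_pos_right (by linarith) hs
  refine ⟨hψ, h13, fun a ha => ?_⟩
  have hW : ∀ x, 0 ≤ x → W x = κ * (Real.exp (θ₁ * x) - Real.exp (θ₂ * x)) :=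
    fun x hx => if_neg (not_lt.2 hx)
  have hK : γ * κ * (θ₁ - θ₂) = (θ₃ - θ₁) * (θ₃ - θ₂) := by
    rw [h3]
    change γ * (1 / Δ) * ((-c + Δ) / σ ^ 2 - (-c - Δ) / σ ^ 2) =
      ((-c + E) / σ ^ 2 - (-c + Δ) / σ ^ 2) * ((-c + E) / σ ^ 2 - (-c - Δ) / σ ^ 2)
    have hne := hΔ.ne'
    clear_value Δ
    field_simp
    linear_combination Δ * (hΔ2 - hE2)
  have hint : ∫ u in (0 : ℝ)..a, Real.exp (-θ₃ * u) * W u = ∫ u in (0 : ℝ)..a,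
      Real.exp (-θ₃ * u) * (κ * (Real.exp (θ₁ * u) - Real.exp (θ₂ * u))) := by
    refine intervalIntegral.integral_congr fun u hu => ?_
    rw [Set.uIcc_of_le ha] at hu
    change Real.exp (-θ₃ * u) * W u = _
    rw [hW u hu.1]
  change Real.exp (θ₃ * a) *
        (1 + (δ - ψ θ₃) * ∫ u in (0 : ℝ)..a, Real.exp (-θ₃ * u) * W u) = _
  rw [hint, hψ, hW a ha, show δ - (δ + γ) = -γ by ring]
  exact aux_Z θ₁ θ₂ θ₃ κ γ a h13 h23 hK
end

section
/- For every a ≥ 0, the partial derivative Z_δ'(a, θ₃) := θ₃ Z_δ(a, θ₃) + (δ − ψ(θ₃)) W_δ(a) = θ₃ Z_δ(a, θ₃) − γ W_δ(a) admits the closed form Z_δ'(a, θ₃) = (γθ₁/(θ₃ − θ₁)) W_δ(a) + θ₃ e^{θ₂ a} (note δ − ψ(θ₃) = −γ and θ₃ > θ₁). -/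
open Real intervalIntegral

lemma aux_exp_int (m a : ℝ) (hm : m ≠ 0) :
    ∫ u in (0 : ℝ)..a, Real.exp (m * u) = (Real.exp (m * a) - 1) / m := by
  have h : ∀ x ∈ Set.uIcc 0 a, HasDerivAt (fun u => Real.exp (m * u) / m) (Real.exp (m * x)) x := by
    intro x _
    have h1 : HasDerivAt (fun u : ℝ => m * u) m x := by
      simpa using (hasDerivAt_id x).const_mul m
    have h2 := h1.exp.div_const m
    rwa [mul_div_assoc, div_self hm, mul_one] at h2
  rw [integral_eq_sub_of_hasDerivAt h (Continuous.intervalIntegrable (by fun_prop) _ _)]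
  simp
  ring

lemma aux_main (t1 t2 t3 k g a : ℝ) (h1 : t1 < t3) (h2 : t2 < t3) (ha : 0 ≤ a)
    (hg : g * k * (t1 - t2) = (t3 - t1) * (t3 - t2)) :
    t3 * (Real.exp (t3 * a) * (1 + (-g) * ∫ u in (0 : ℝ)..a, Real.exp (-t3 * u) *
      (if u < 0 then 0 else k * (Real.exp (t1 * u) - Real.exp (t2 * u)))))
      + (-g) * (k * (Real.exp (t1 * a) - Real.exp (t2 * a)))
    = g * t1 / (t3 - t1) * (k * (Real.exp (t1 * a) - Real.exp (t2 * a)))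
      + t3 * Real.exp (t2 * a) := by
  have e1 : ∫ u in (0 : ℝ)..a, Real.exp (-t3 * u) *
      (if u < 0 then 0 else k * (Real.exp (t1 * u) - Real.exp (t2 * u)))
      = ∫ u in (0 : ℝ)..a, (k * Real.exp ((t1 - t3) * u) - k * Real.exp ((t2 - t3) * u)) := by
    apply integral_congr
    intro u hu
    rw [Set.uIcc_of_le ha] at hu
    have a1 : (t1 - t3) * u = -t3 * u + t1 * u := by ring
    have a2 : (t2 - t3) * u = -t3 * u + t2 * u := by ring
    simp only [not_lt.mpr hu.1, if_false, a1, a2, Real.exp_add]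
    ring
  have d1 : t3 - t1 ≠ 0 := by linarith
  have d2 : t3 - t2 ≠ 0 := by linarith
  have d1' : t1 - t3 ≠ 0 := by linarith
  have d2' : t2 - t3 ≠ 0 := by linarith
  rw [e1, integral_sub (Continuous.intervalIntegrable (by fun_prop) _ _)
    (Continuous.intervalIntegrable (by fun_prop) _ _), integral_const_mul, integral_const_mul,
    aux_exp_int _ _ d1', aux_exp_int _ _ d2']
  have b1 : Real.exp (t1 * a) = Real.exp (t3 * a) * Real.exp ((t1 - t3) * a) := by
    rw [← Real.exp_add]; ring_nf
  have b2 : Real.exp (t2 * a) = Real.exp (t3 * a) * Real.exp ((t2 - t3) * a) := by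
    rw [← Real.exp_add]; ring_nf
  rw [b1, b2]
  generalize Real.exp ((t1 - t3) * a) = X
  generalize Real.exp ((t2 - t3) * a) = Y
  generalize Real.exp (t3 * a) = E
  obtain ⟨p, rfl⟩ : ∃ p, t1 = t3 - p := ⟨t3 - t1, by ring⟩
  obtain ⟨q, rfl⟩ : ∃ q, t2 = t3 - q := ⟨t3 - t2, by ring⟩
  have hp : p ≠ 0 := by linarith
  have hq : q ≠ 0 := by linarith
  have r1 : t3 - p - t3 = -p := by ring
  have r2 : t3 - q - t3 = -q := by ring
  have r3 : t3 - (t3 - p) = p := by ring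
  rw [r1, r2, r3]
  have hg' : g * k * (q - p) = p * q := by linear_combination hg
  field_simp
  linear_combination (-(t3 * E) + t3 * E * Y) * hg'

theorem brownian_Z_two_param_derivative_closed_form
    (c σ δ γ : ℝ) (hσ : 0 < σ) (hδ : 0 < δ) (hγ : 0 < γ) :
    let ψ : ℝ → ℝ := fun θ => c * θ + σ ^ 2 / 2 * θ ^ 2
    let Δ : ℝ := Real.sqrt (c ^ 2 + 2 * δ * σ ^ 2)
    let θ₁ : ℝ := (-c + Δ) / σ ^ 2
    let θ₂ : ℝ := (-c - Δ) / σ ^ 2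
    let κ : ℝ := 1 / Δ
    let W : ℝ → ℝ := fun x =>
      if x < 0 then 0 else κ * (Real.exp (θ₁ * x) - Real.exp (θ₂ * x))
    let θ₃ : ℝ := (-c + Real.sqrt (c ^ 2 + 2 * (δ + γ) * σ ^ 2)) / σ ^ 2
    let Z : ℝ → ℝ → ℝ := fun a θ =>
      Real.exp (θ * a) *
        (1 + (δ - ψ θ) * ∫ u in (0 : ℝ)..a, Real.exp (-θ * u) * W u)
    δ - ψ θ₃ = -γ ∧ θ₁ < θ₃ ∧
      ∀ a : ℝ, 0 ≤ a →
        θ₃ * Z a θ₃ + (δ - ψ θ₃) * W a =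
          γ * θ₁ / (θ₃ - θ₁) * W a + θ₃ * Real.exp (θ₂ * a) := by
  intro ψ Δ θ₁ θ₂ κ W θ₃ Z
  have hs : 0 < σ ^ 2 := by positivity
  have hs' : σ ≠ 0 := hσ.ne'
  have hA : 0 < c ^ 2 + 2 * δ * σ ^ 2 := by positivity
  have hB : c ^ 2 + 2 * δ * σ ^ 2 < c ^ 2 + 2 * (δ + γ) * σ ^ 2 := by nlinarith [mul_pos hγ hs]
  have hD : 0 < Δ := Real.sqrt_pos.mpr hA
  have hD2 : Δ ^ 2 = c ^ 2 + 2 * δ * σ ^ 2 := Real.sq_sqrt hA.le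
  obtain ⟨R, hR⟩ : ∃ R, R = Real.sqrt (c ^ 2 + 2 * (δ + γ) * σ ^ 2) := ⟨_, rfl⟩
  have hR2 : R ^ 2 = c ^ 2 + 2 * (δ + γ) * σ ^ 2 := by
    rw [hR]; exact Real.sq_sqrt (hA.trans hB).le
  have hDR : Δ < R := by rw [hR]; exact Real.sqrt_lt_sqrt hA.le hB
  have h3 : θ₃ = (-c + R) / σ ^ 2 := by rw [hR]
  have hψ : δ - ψ θ₃ = -γ := by
    simp only [ψ, h3]
    field_simp
    linear_combination (-1) * hR2
  have h13 : θ₁ < θ₃ := by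
    rw [h3]; exact div_lt_div_of_pos_right (by linarith) hs
  have h23 : θ₂ < θ₃ := by
    rw [h3]; exact div_lt_div_of_pos_right (by linarith) hs
  refine ⟨hψ, h13, fun a ha => ?_⟩
  have hg : γ * κ * (θ₁ - θ₂) = (θ₃ - θ₁) * (θ₃ - θ₂) := by
    rw [h3]
    simp only [κ, θ₁, θ₂]
    clear_value Δ
    field_simp
    linear_combination Δ * (hD2 - hR2)
  have := aux_main θ₁ θ₂ θ₃ κ γ a h13 h23 ha hg
  have hW : W a = κ * (Real.exp (θ₁ * a) - Real.exp (θ₂ * a)) := if_neg (not_lt.mpr ha)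
  simp only [Z]
  rw [hψ, hW]
  exact this
end

section
/- The scale functions at levels δ and δ+γ satisfy the resolvent convolution identity: for every x ≥ 0, W_{δ+γ}(x) = W_δ(x) + γ ∫₀ˣ W_{δ+γ}(x − u) W_δ(u) du. -/
open Real intervalIntegral

lemma resolvent_aux (s c d g a b p q k l x : ℝ)
    (ha : s * a ^ 2 + c * a = d) (hb : s * b ^ 2 + c * b = d)
    (hp : s * p ^ 2 + c * p = d + g) (hq : s * q ^ 2 + c * q = d + g)
    (hk : s * (k * (a - b)) = 1) (hl : s * (l * (p - q)) = 1) :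
    l * (Real.exp (p * x) - Real.exp (q * x)) = k * (Real.exp (a * x) - Real.exp (b * x)) +
      g * ∫ u in (0 : ℝ)..x, (l * (Real.exp (p * (x - u)) - Real.exp (q * (x - u)))) *
        (k * (Real.exp (a * u) - Real.exp (b * u))) := by
  have hE : ∀ r u : ℝ, HasDerivAt (fun u => Real.exp (r * u)) (Real.exp (r * u) * r) u := by
    intro r u
    simpa using ((hasDerivAt_id u).const_mul r).exp
  have hG : ∀ r u : ℝ, HasDerivAt (fun u => Real.exp (r * (x - u)))
      (Real.exp (r * (x - u)) * (-r)) u := by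
    intro r u
    simpa using (((hasDerivAt_id u).const_sub x).const_mul r).exp
  have key : ∀ u : ℝ, HasDerivAt (fun u =>
      -(s * ((k * (a * Real.exp (a * u) - b * Real.exp (b * u))) *
          (l * (Real.exp (p * (x - u)) - Real.exp (q * (x - u)))) +
        (k * (Real.exp (a * u) - Real.exp (b * u))) *
          (l * (p * Real.exp (p * (x - u)) - q * Real.exp (q * (x - u))))) +
      c * ((k * (Real.exp (a * u) - Real.exp (b * u))) *
          (l * (Real.exp (p * (x - u)) - Real.exp (q * (x - u)))))))
      (g * ((l * (Real.exp (p * (x - u)) - Real.exp (q * (x - u)))) *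
        (k * (Real.exp (a * u) - Real.exp (b * u))))) u := by
    intro u
    have f0 := ((hE a u).sub (hE b u)).const_mul k
    have f1 := (((hE a u).const_mul a).sub ((hE b u).const_mul b)).const_mul k
    have h0 := ((hG p u).sub (hG q u)).const_mul l
    have h1 := (((hG p u).const_mul p).sub ((hG q u).const_mul q)).const_mul l
    have := ((((f1.mul h0).add (f0.mul h1)).const_mul s).add ((f0.mul h0).const_mul c)).neg
    refine this.congr_deriv ?_
    simp only [Pi.sub_apply]
    generalize Real.exp (a * u) = A
    generalize Real.exp (b * u) = B
    generalize Real.exp (p * (x - u)) = P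
    generalize Real.exp (q * (x - u)) = Q
    linear_combination (-k * l * A * (P - Q)) * ha + (k * l * B * (P - Q)) * hb
      + (k * l * P * (A - B)) * hp - (k * l * Q * (A - B)) * hq
  rw [← intervalIntegral.integral_const_mul,
    intervalIntegral.integral_eq_sub_of_hasDerivAt (fun u _ => key u)
      (Continuous.intervalIntegrable (by fun_prop) _ _)]
  simp only [sub_self, mul_zero, Real.exp_zero, sub_zero]
  linear_combination (-(l * (Real.exp (p * x) - Real.exp (q * x)))) * hk
    + (k * (Real.exp (a * x) - Real.exp (b * x))) * hl

theorem brownian_scale_function_resolvent_identity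
    (c σ δ γ : ℝ) (hσ : 0 < σ) (hδ : 0 < δ) (hγ : 0 < γ) :
    let Δ : ℝ := Real.sqrt (c ^ 2 + 2 * δ * σ ^ 2)
    let θ₁ : ℝ := (-c + Δ) / σ ^ 2
    let θ₂ : ℝ := (-c - Δ) / σ ^ 2
    let κ : ℝ := 1 / Δ
    let W : ℝ → ℝ := fun x =>
      if x < 0 then 0 else κ * (Real.exp (θ₁ * x) - Real.exp (θ₂ * x))
    let Δg : ℝ := Real.sqrt (c ^ 2 + 2 * (δ + γ) * σ ^ 2)
    let θ₃ : ℝ := (-c + Δg) / σ ^ 2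
    let θ₄ : ℝ := (-c - Δg) / σ ^ 2
    let l : ℝ := 1 / Δg
    let Wg : ℝ → ℝ := fun x =>
      if x < 0 then 0 else l * (Real.exp (θ₃ * x) - Real.exp (θ₄ * x))
    ∀ x : ℝ, 0 ≤ x →
      Wg x = W x + γ * ∫ u in (0 : ℝ)..x, Wg (x - u) * W u := by
  intro Δ θ₁ θ₂ κ W Δg θ₃ θ₄ l Wg x hx
  have hΔ : 0 < Δ := Real.sqrt_pos.mpr (by positivity)
  have hΔg : 0 < Δg := Real.sqrt_pos.mpr (by positivity)
  have hΔ2 : Δ ^ 2 = c ^ 2 + 2 * δ * σ ^ 2 := Real.sq_sqrt (by positivity)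
  have hΔg2 : Δg ^ 2 = c ^ 2 + 2 * (δ + γ) * σ ^ 2 := Real.sq_sqrt (by positivity)
  have hint : ∫ u in (0 : ℝ)..x, Wg (x - u) * W u =
      ∫ u in (0 : ℝ)..x, (l * (Real.exp (θ₃ * (x - u)) - Real.exp (θ₄ * (x - u)))) *
        (κ * (Real.exp (θ₁ * u) - Real.exp (θ₂ * u))) := by
    apply intervalIntegral.integral_congr
    intro u hu
    rw [Set.uIcc_of_le hx] at hu
    have h1 : ¬ (x - u < 0) := by linarith [hu.2]
    have h2 : ¬ (u < 0) := by linarith [hu.1]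
    simp only [Wg, W, if_neg h1, if_neg h2]
  rw [hint]
  have h0 : ¬ (x < 0) := not_lt.mpr hx
  simp only [Wg, W, if_neg h0]
  clear_value Δ Δg
  apply resolvent_aux (σ ^ 2 / 2) c δ γ
  · simp only [θ₁]; field_simp; linear_combination hΔ2
  · simp only [θ₂]; field_simp; linear_combination hΔ2
  · simp only [θ₃]; field_simp; linear_combination hΔg2
  · simp only [θ₄]; field_simp; linear_combination hΔg2
  · simp only [θ₁, θ₂, κ]; field_simp; ring
  · simp only [θ₃, θ₄, l]; field_simp; ring
end

section
/- Let c > 0, σ > 0, γ > 0, a > 0 and x ≥ 0 be fixed. For δ > 0 define (all depending on δ): θ₁ = (−c + √(c² + 2δσ²))/σ², θ₂ = (−c − √(c² + 2δσ²))/σ², W_δ(u) = (e^{θ₁u} − e^{θ₂u})/√(c² + 2δσ²) for u ≥ 0 (0 for u < 0); θ₃ = (−c + √(c² + 2(δ+γ)σ²))/σ², θ₄ = (−c − √(c² + 2(δ+γ)σ²))/σ², W_{δ+γ}(u) = (e^{θ₃u} − e^{θ₄u})/√(c² + 2(δ+γ)σ²) for u ≥ 0 (0 for u < 0); Z_δ(u)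 = 1 + δ∫₀^u W_δ; Z_δ(a,θ₃) = e^{θ₃a}(1 − γ∫₀^a e^{−θ₃v} W_δ(v) dv); Z_δ'(a,θ₃) = θ₃ Z_δ(a,θ₃) − γ W_δ(a); I_a^{(δ,γ)}(x) = [W_δ(x+a) + γ∫₀ˣ W_{δ+γ}(x−u) W_δ(u+a) du]/W_δ(a) − γ∫₀ˣ W_{δ+γ}(u) du; and J_a^{(δ,γ)}(x) = Z_δ(x+a) + γ∫₀ˣ W_{δ+γ}(x−u) Z_δ(u+a) du − γ Z_δ(a) ∫₀ˣ W_{δ+γ}(u) du. Then the explicit Laplace transform of the ruin time from Theorem 4.1 (case of initial surplus above the ratcheting barrier) tends to 1 as the discount rate vanishes: lim_{δ→0⁺} [ J_a^{(δ,γ)}(x) − I_a^{(δ,γ)}(x) · δ W_δ(a) Z_δ(a,θ₃) / Z_δ'(a,θ₃) ] = 1. -/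
open Real Filter Topology intervalIntegral

lemma aux_core (γ a x : ℝ) (T : ℝ → ℝ) (W Wg : ℝ → ℝ → ℝ) (hT : Continuous T)
    (hW : Continuous fun p : ℝ × ℝ => W p.1 p.2) (hWg : Continuous fun p : ℝ × ℝ => Wg p.1 p.2)
    (h1 : W 0 a ≠ 0)
    (h2 : T 0 * (Real.exp (T 0 * a) *
        (1 - γ * ∫ v in (0 : ℝ)..a, Real.exp (-T 0 * v) * W 0 v)) - γ * W 0 a ≠ 0) :
    let Z : ℝ → ℝ → ℝ := fun δ u => 1 + |δ| * ∫ v in (0 : ℝ)..u, W δ v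
    let Za : ℝ → ℝ := fun δ =>
      Real.exp (T δ * a) *
        (1 - γ * ∫ v in (0 : ℝ)..a, Real.exp (-T δ * v) * W δ v)
    let Za' : ℝ → ℝ := fun δ => T δ * Za δ - γ * W δ a
    let I : ℝ → ℝ := fun δ =>
      (W δ (x + a) + γ * ∫ u in (0 : ℝ)..x, Wg δ (x - u) * W δ (u + a)) / W δ a
        - γ * ∫ u in (0 : ℝ)..x, Wg δ u
    let J : ℝ → ℝ := fun δ =>
      Z δ (x + a) + γ * (∫ u in (0 : ℝ)..x, Wg δ (x - u) * Z δ (u + a))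
        - γ * Z δ a * ∫ u in (0 : ℝ)..x, Wg δ u
    Tendsto (fun δ => J δ - I δ * (|δ| * W δ a * Za δ / Za' δ)) (nhds 0) (nhds 1) := by
  intro Z Za Za' I J
  have cW : ∀ {X : Type} [TopologicalSpace X] {f g : X → ℝ}, Continuous f → Continuous g →
      Continuous fun p => W (f p) (g p) := fun hf hg => hW.comp (hf.prodMk hg)
  have cWg : ∀ {X : Type} [TopologicalSpace X] {f g : X → ℝ}, Continuous f → Continuous g →
      Continuous fun p => Wg (f p) (g p) := fun hf hg => hWg.comp (hf.prodMk hg)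
  have cZ : Continuous fun p : ℝ × ℝ => Z p.1 p.2 := by
    refine continuous_const.add (continuous_fst.abs.mul ?_)
    exact continuous_parametric_intervalIntegral_of_continuous
      (f := fun (p : ℝ × ℝ) v => W p.1 v) (s := fun p => p.2)
      (cW (by fun_prop) (by fun_prop)) (by fun_prop)
  have cZ' : ∀ {X : Type} [TopologicalSpace X] {f g : X → ℝ}, Continuous f → Continuous g →
      Continuous fun p => Z (f p) (g p) := fun hf hg => cZ.comp (hf.prodMk hg)
  have cZa : Continuous Za := by
    refine (by fun_prop : Continuous fun δ => Real.exp (T δ * a)).mul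
      (continuous_const.sub (continuous_const.mul ?_))
    refine continuous_parametric_intervalIntegral_of_continuous'
      (f := fun δ v => Real.exp (-T δ * v) * W δ v) ?_ _ _
    exact (by fun_prop : Continuous fun p : ℝ × ℝ => Real.exp (-T p.1 * p.2)).mul hW
  have cWa : Continuous fun δ => W δ a := cW (by fun_prop) (by fun_prop)
  have cZa' : Continuous Za' := (hT.mul cZa).sub (continuous_const.mul cWa)
  have ciWg : Continuous fun δ => ∫ u in (0 : ℝ)..x, Wg δ u :=
    continuous_parametric_intervalIntegral_of_continuous' (f := fun δ u => Wg δ u) hWg _ _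
  have cI : ContinuousAt I 0 := by
    refine ContinuousAt.sub (ContinuousAt.div (Continuous.continuousAt ?_) cWa.continuousAt h1)
      (continuous_const.mul ciWg).continuousAt
    refine (cW (by fun_prop) (by fun_prop)).add (continuous_const.mul ?_)
    exact continuous_parametric_intervalIntegral_of_continuous'
      (f := fun δ u => Wg δ (x - u) * W δ (u + a))
      ((cWg (by fun_prop) (by fun_prop)).mul (cW (by fun_prop) (by fun_prop))) _ _
  have cJ : Continuous J := by
    refine ((cZ' (by fun_prop) (by fun_prop)).add (continuous_const.mul ?_)).sub
      ((continuous_const.mul (cZ' (by fun_prop) (by fun_prop))).mul ciWg)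
    exact continuous_parametric_intervalIntegral_of_continuous'
      (f := fun δ u => Wg δ (x - u) * Z δ (u + a))
      ((cWg (by fun_prop) (by fun_prop)).mul (cZ' (by fun_prop) (by fun_prop))) _ _
  have main : ContinuousAt (fun δ => J δ - I δ * (|δ| * W δ a * Za δ / Za' δ)) 0 := by
    refine cJ.continuousAt.sub (cI.mul (ContinuousAt.div (Continuous.continuousAt ?_)
      cZa'.continuousAt h2))
    exact (continuous_abs.mul cWa).mul cZa
  have e : J 0 - I 0 * (|0| * W 0 a * Za 0 / Za' 0) = 1 := by
    have hJ : J 0 = 1 := by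
      simp only [J, Z, abs_zero, zero_mul, add_zero, mul_one]
      rw [intervalIntegral.integral_comp_sub_left (fun u => Wg 0 u) x]
      simp
    rw [hJ]; simp
  have := main.tendsto
  simp only [e] at this
  exact this

lemma aux_int_s15 (c k t a : ℝ) (ht : t ≠ 0) (hk : t + k ≠ 0) :
    ∫ v in (0 : ℝ)..a, Real.exp (-t * v) * ((1 - Real.exp (-k * v)) / c) =
      ((1 - Real.exp (-t * a)) / t - (1 - Real.exp (-t * a) * Real.exp (-k * a)) / (t + k)) / c := by
  have hd : ∀ v ∈ Set.uIcc 0 a, HasDerivAt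
      (fun v : ℝ => ((1 - Real.exp (-t * v)) / t
        - (1 - Real.exp (-t * v) * Real.exp (-k * v)) / (t + k)) / c)
      (Real.exp (-t * v) * ((1 - Real.exp (-k * v)) / c)) v := by
    intro v _
    have e1 : HasDerivAt (fun v : ℝ => Real.exp (-t * v)) (Real.exp (-t * v) * (-t)) v := by
      simpa using ((hasDerivAt_id v).const_mul (-t)).exp
    have e2 : HasDerivAt (fun v : ℝ => Real.exp (-k * v)) (Real.exp (-k * v) * (-k)) v := by
      simpa using ((hasDerivAt_id v).const_mul (-k)).exp
    have e3 := ((((e1.const_sub 1).div_const t)).sub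
      ((((e1.mul e2).const_sub 1).div_const (t + k)))).div_const c
    refine e3.congr_deriv ?_
    rw [← mul_div_assoc]
    congr 1
    field_simp
    ring
  rw [intervalIntegral.integral_eq_sub_of_hasDerivAt hd
    (Continuous.intervalIntegrable (by fun_prop) _ _)]
  simp

lemma aux_if (s t q u : ℝ) : (if u < 0 then 0 else (Real.exp (s * u) - Real.exp (t * u)) / q) =
    (Real.exp (s * max u 0) - Real.exp (t * max u 0)) / q := by
  split_ifs with h
  · simp [max_eq_right h.le]
  · rw [max_eq_left (not_lt.mp h)]

theorem brownian_ruin_laplace_transform_tendsto_one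
    (c σ γ a x : ℝ) (hc : 0 < c) (hσ : 0 < σ) (hγ : 0 < γ)
    (ha : 0 < a) (hx : 0 ≤ x) :
    let θ₁ : ℝ → ℝ := fun δ =>
      (-c + Real.sqrt (c ^ 2 + 2 * δ * σ ^ 2)) / σ ^ 2
    let θ₂ : ℝ → ℝ := fun δ =>
      (-c - Real.sqrt (c ^ 2 + 2 * δ * σ ^ 2)) / σ ^ 2
    let W : ℝ → ℝ → ℝ := fun δ u =>
      if u < 0 then 0 else
        (Real.exp (θ₁ δ * u) - Real.exp (θ₂ δ * u)) /
          Real.sqrt (c ^ 2 + 2 * δ * σ ^ 2)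
    let θ₃ : ℝ → ℝ := fun δ =>
      (-c + Real.sqrt (c ^ 2 + 2 * (δ + γ) * σ ^ 2)) / σ ^ 2
    let θ₄ : ℝ → ℝ := fun δ =>
      (-c - Real.sqrt (c ^ 2 + 2 * (δ + γ) * σ ^ 2)) / σ ^ 2
    let Wg : ℝ → ℝ → ℝ := fun δ u =>
      if u < 0 then 0 else
        (Real.exp (θ₃ δ * u) - Real.exp (θ₄ δ * u)) /
          Real.sqrt (c ^ 2 + 2 * (δ + γ) * σ ^ 2)
    let Z : ℝ → ℝ → ℝ := fun δ u => 1 + δ * ∫ v in (0 : ℝ)..u, W δ v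
    let Za : ℝ → ℝ := fun δ =>
      Real.exp (θ₃ δ * a) *
        (1 - γ * ∫ v in (0 : ℝ)..a, Real.exp (-θ₃ δ * v) * W δ v)
    let Za' : ℝ → ℝ := fun δ => θ₃ δ * Za δ - γ * W δ a
    let I : ℝ → ℝ := fun δ =>
      (W δ (x + a) + γ * ∫ u in (0 : ℝ)..x, Wg δ (x - u) * W δ (u + a)) / W δ a
        - γ * ∫ u in (0 : ℝ)..x, Wg δ u
    let J : ℝ → ℝ := fun δ =>
      Z δ (x + a) + γ * (∫ u in (0 : ℝ)..x, Wg δ (x - u) * Z δ (u + a))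
        - γ * Z δ a * ∫ u in (0 : ℝ)..x, Wg δ u
    Tendsto (fun δ => J δ - I δ * (δ * W δ a * Za δ / Za' δ))
      (nhdsWithin 0 (Set.Ioi (0 : ℝ))) (nhds 1) := by
  intro θ₁ θ₂ W θ₃ θ₄ Wg Z Za Za' I J
  have hs : ∀ δ : ℝ, Real.sqrt (c ^ 2 + 2 * |δ| * σ ^ 2) ≠ 0 := fun δ => by positivity
  have hsg : ∀ δ : ℝ, Real.sqrt (c ^ 2 + 2 * (|δ| + γ) * σ ^ 2) ≠ 0 := fun δ => by positivity
  have hT : Continuous fun δ => θ₃ |δ| := by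
    simp only [θ₃]; fun_prop
  have hW : Continuous fun p : ℝ × ℝ => W |p.1| p.2 := by
    simp only [W, aux_if, θ₁, θ₂]
    exact Continuous.div (by fun_prop) (by fun_prop) fun p => hs p.1
  have hWg : Continuous fun p : ℝ × ℝ => Wg |p.1| p.2 := by
    simp only [Wg, aux_if, θ₃, θ₄]
    exact Continuous.div (by fun_prop) (by fun_prop) fun p => hsg p.1
  have hW0 : ∀ u, 0 ≤ u → W 0 u = (1 - Real.exp (-(2 * c / σ ^ 2) * u)) / c := by
    intro u hu
    have e : Real.sqrt (c ^ 2 + 2 * 0 * σ ^ 2) = c := by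
      simp [Real.sqrt_sq hc.le]
    simp only [W, θ₁, θ₂, if_neg (not_lt.mpr hu), e]
    congr 2
    · simp
    · congr 2; ring
  set k := 2 * c / σ ^ 2 with hk
  have hkp : 0 < k := by positivity
  set t := θ₃ 0 with ht
  have htp : 0 < t := by
    simp only [ht, θ₃]
    apply div_pos _ (by positivity)
    have : c < Real.sqrt (c ^ 2 + 2 * (0 + γ) * σ ^ 2) := by
      apply Real.lt_sqrt_of_sq_lt
      have : 0 < 2 * (0 + γ) * σ ^ 2 := by positivity
      linarith
    linarith
  have hq : c * t * (t + k) = k * γ := by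
    have h := Real.sq_sqrt (show 0 ≤ c ^ 2 + 2 * (0 + γ) * σ ^ 2 by positivity)
    simp only [ht, θ₃, hk]
    field_simp
    ring_nf at h ⊢
    rw [h]; ring
  have hWa : W 0 a ≠ 0 := by
    rw [hW0 a ha.le]
    have : Real.exp (-k * a) < 1 := by
      rw [Real.exp_lt_one_iff]; nlinarith [mul_pos hkp ha]
    exact (div_pos (by linarith) hc).ne'
  have hint : ∫ v in (0 : ℝ)..a, Real.exp (-t * v) * W 0 v =
      ((1 - Real.exp (-t * a)) / t
        - (1 - Real.exp (-t * a) * Real.exp (-k * a)) / (t + k)) / c := by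
    rw [← aux_int_s15 c k t a htp.ne' (by positivity)]
    apply intervalIntegral.integral_congr
    intro v hv
    rw [Set.uIcc_of_le ha.le] at hv
    simp only [hW0 v hv.1]
  have hZ : t * (Real.exp (t * a) *
        (1 - γ * ∫ v in (0 : ℝ)..a, Real.exp (-t * v) * W 0 v)) - γ * W 0 a ≠ 0 := by
    have e : t * (Real.exp (t * a) *
        (1 - γ * ∫ v in (0 : ℝ)..a, Real.exp (-t * v) * W 0 v)) - γ * W 0 a
        = γ / c * Real.exp (-k * a) * (k / (t + k)) := by
      rw [hint, hW0 a ha.le]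
      have h3 : Real.exp (-t * a) = (Real.exp (t * a))⁻¹ := by
        rw [← Real.exp_neg]; ring_nf
      rw [h3]
      have hE := (Real.exp_pos (t * a)).ne'
      generalize Real.exp (t * a) = E at *
      generalize Real.exp (-k * a) = F at *
      have htk : t + k ≠ 0 := by positivity
      have := htp.ne'
      have := hc.ne'
      clear_value t k
      field_simp
      linear_combination E * hq
    rw [e]; positivity
  have key := aux_core γ a x (fun δ => θ₃ |δ|) (fun δ => W |δ|) (fun δ => Wg |δ|) hT hW hWg
    (by simpa only [abs_zero] using hWa) (by simpa only [abs_zero] using hZ)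
  refine (key.mono_left nhdsWithin_le_nhds).congr' ?_
  filter_upwards [self_mem_nhdsWithin] with δ hδ
  simp only [abs_of_pos (Set.mem_Ioi.mp hδ)]
  rfl
end
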